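/- Let (Ω,Σ,P) be a probability space and let K be a convex set of random variables that is bounded in L^1(P) and closed in the topology of convergence in P-probability. The following are equivalent: (1) there exists a probability measure Q equivalent to P such that the L^0(Q)- and L^1(Q)-topologies agree on K, i.e., for every sequence (X_n) in K and every X ∈ K, (X_n) converges to X in P-probability if and only if E_Q[|X_n − X|] → 0; (2) there exists a probability measure Q equivalent to P such that K is Q-uniformly integrable. -/

import Mathlib

open MeasureTheory Filter Set ProbabilityTheory

noncomputable section

namespace Paper

variable {Ω : Type*} [MeasurableSpace Ω]

/-- The metric `d(X,Y) = E_P[min(|X - Y|, 1)]` metrizing convergence in `P`-probability. -/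
def probDist (P : Measure Ω) (X Y : Ω → ℝ) : ℝ :=
  ∫ ω, min |X ω - Y ω| 1 ∂P

/-- `Q` is a probability measure equivalent to `P` (mutually absolutely continuous). -/
def EquivProb (P Q : Measure Ω) : Prop :=
  IsProbabilityMeasure Q ∧ Q ≪ P ∧ P ≪ Q

/-- `K` is a set of `P`-integrable random variables bounded in `L¹(P)`. -/
def BddL1 (P : Measure Ω) (K : Set (Ω → ℝ)) : Prop :=
  (∀ X ∈ K, Integrable X P) ∧ ∃ C : ℝ, ∀ X ∈ K, (∫ ω, |X ω| ∂P) ≤ C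

/-- `K` is `Q`-uniformly integrable: all members are `Q`-integrable and
`sup_{X ∈ K} E_Q[|X| · 1_{|X| > c}] → 0` as `c → ∞`. -/
def UIset (Q : Measure Ω) (K : Set (Ω → ℝ)) : Prop :=
  (∀ X ∈ K, Integrable X Q) ∧
  ∀ ε : ℝ, 0 < ε → ∃ c : ℝ, ∀ X ∈ K, (∫ ω in {ω | c < |X ω|}, |X ω| ∂Q) < ε

/-- The sequence `Xs` is Cauchy in `P`-probability. -/
def CauchyInProb (P : Measure Ω) (Xs : ℕ → Ω → ℝ) : Prop :=
  ∀ ε : ℝ, 0 < ε →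
    Tendsto (fun p : ℕ × ℕ => P {ω | ε ≤ |Xs p.1 ω - Xs p.2 ω|}) atTop (nhds 0)

/-- The (sequential) closure of `K` in the topology of convergence in `P`-probability. -/
def probClosure (P : Measure Ω) (K : Set (Ω → ℝ)) : Set (Ω → ℝ) :=
  {X | ∃ Xs : ℕ → Ω → ℝ, (∀ n, Xs n ∈ K) ∧ TendstoInMeasure P Xs atTop X}

/-- A set `W` of random variables is solid: if `X ∈ W` and `|Y| ≤ |X|` a.s. then `Y ∈ W`. -/
def SolidSet (P : Measure Ω) (W : Set (Ω → ℝ)) : Prop :=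
  ∀ X ∈ W, ∀ Y : Ω → ℝ, AEStronglyMeasurable Y P →
    (∀ᵐ ω ∂P, |Y ω| ≤ |X ω|) → Y ∈ W

/-- The solid hull of a set `A` of random variables. -/
def solidHull (P : Measure Ω) (A : Set (Ω → ℝ)) : Set (Ω → ℝ) :=
  {Y | AEStronglyMeasurable Y P ∧ ∃ X ∈ A, ∀ᵐ ω ∂P, |Y ω| ≤ |X ω|}

/-- The relative `L⁰(P)`-topology on `K` is uniformly locally convex-solid on `S`:
for every `ε > 0` there is a convex solid set `W` of integrable random variables contained in the
`ε`-ball around `0` such that, for each `X ∈ S`, `(X + W) ∩ K` contains a `d`-ball of `K`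
around `X`. -/
def UnifLCS (P : Measure Ω) (K S : Set (Ω → ℝ)) : Prop :=
  ∀ ε : ℝ, 0 < ε → ∃ W : Set (Ω → ℝ),
    (∀ Z ∈ W, Integrable Z P) ∧ Convex ℝ W ∧ SolidSet P W ∧
    (∀ Z ∈ W, probDist P Z 0 < ε) ∧
    ∀ X ∈ S, ∃ δ : ℝ, 0 < δ ∧ ∀ Z ∈ K, probDist P Z X < δ → Z - X ∈ W

/-- The `L⁰(Q)`- and `L¹(Q)`-topologies agree on `K`: a sequence in `K` converges in
`P`-probability to a member of `K` iff it converges in `L¹(Q)`-norm. -/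
def TopAgree (P Q : Measure Ω) (K : Set (Ω → ℝ)) : Prop :=
  ∀ (Xs : ℕ → Ω → ℝ) (X : Ω → ℝ), (∀ n, Xs n ∈ K) → X ∈ K →
    (TendstoInMeasure P Xs atTop X ↔
      Tendsto (fun n => ∫⁻ ω, ENNReal.ofReal |Xs n ω - X ω| ∂Q) atTop (nhds 0))

/-- `W` is a forward convex combination of the sequence `Z`. -/
def IsFCC (Z : ℕ → Ω → ℝ) (W : ℕ → Ω → ℝ) : Prop :=
  ∀ k, W k ∈ convexHull ℝ (Z '' {n | k ≤ n})

/-- The relative `L⁰(P)`-topology on `K` is locally convex at `X` (forward convex combination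
formulation): every FCC of a sequence in `K` converging to `X` in probability also converges
to `X` in probability. -/
def LocConvexAt (P : Measure Ω) (K : Set (Ω → ℝ)) (X : Ω → ℝ) : Prop :=
  ∀ Xs : ℕ → Ω → ℝ, (∀ n, Xs n ∈ K) → TendstoInMeasure P Xs atTop X →
    ∀ W : ℕ → Ω → ℝ, IsFCC Xs W → TendstoInMeasure P W atTop X

/-- The set `L = {Σ_k a_k R_k : Σ_k |a_k| ≤ 1}` (with pointwise a.e. absolutely convergent
series, which also converge in `L¹(P)`). -/
def Lset (R : ℕ → Ω → ℝ) : Set (Ω → ℝ) :=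
  {G | ∃ a : ℕ → ℝ, Summable (fun k => |a k|) ∧ (∑' k, |a k|) ≤ 1 ∧
    G = fun ω => ∑' k, a k * R k ω}

/-- The standard Cauchy distribution on `ℝ`. -/
def cauchyLaw : Measure ℝ :=
  MeasureTheory.volume.withDensity (fun t => ENNReal.ofReal (1 / (Real.pi * (1 + t ^ 2))))

/-- Local convexity of the relative topology on `A ⊆ E` at a point `x ∈ A`, in a topological
vector space. -/
def LocConvexAtTVS {E : Type*} [AddCommGroup E] [Module ℝ E] [TopologicalSpace E]
    (A : Set E) (x : E) : Prop :=
  ∀ V ∈ nhds (0 : E), ∃ U ∈ nhds (0 : E), ∃ C : Set E,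
    Convex ℝ C ∧ ((fun u => x + u) '' U) ∩ A ⊆ C ∧ C ⊆ ((fun v => x + v) '' V) ∩ A

/-- Quantitative strict convexity of `x ↦ √(1 + x ^ 2)`. -/
theorem sq_div_sqrt_sub_le (a b : ℝ) :
    (a / √(1 + a ^ 2) - b / √(1 + b ^ 2)) ^ 2 ≤
      4 * (√(1 + a ^ 2) + √(1 + b ^ 2) - 2 * √(1 + ((a + b) / 2) ^ 2)) := by
  have hp1 : 1 ≤ √(1 + a ^ 2) := Real.one_le_sqrt.2 (by nlinarith [sq_nonneg a])
  have hq1 : 1 ≤ √(1 + b ^ 2) := Real.one_le_sqrt.2 (by nlinarith [sq_nonneg b])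
  have hr1 : 1 ≤ √(1 + ((a + b) / 2) ^ 2) :=
    Real.one_le_sqrt.2 (by nlinarith [sq_nonneg ((a + b) / 2)])
  have hp2 : √(1 + a ^ 2) ^ 2 = 1 + a ^ 2 := Real.sq_sqrt (by positivity)
  have hq2 : √(1 + b ^ 2) ^ 2 = 1 + b ^ 2 := Real.sq_sqrt (by positivity)
  have hr2 : √(1 + ((a + b) / 2) ^ 2) ^ 2 = 1 + ((a + b) / 2) ^ 2 := Real.sq_sqrt (by positivity)
  set p := √(1 + a ^ 2)
  set q := √(1 + b ^ 2)
  set r := √(1 + ((a + b) / 2) ^ 2)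
  have hp : 0 < p := by linarith
  have hq : 0 < q := by linarith
  have hs : 1 + a * b ≤ p * q := by
    have : (1 + a * b) ^ 2 ≤ (p * q) ^ 2 := by
      rw [mul_pow, hp2, hq2]; nlinarith [sq_nonneg (a - b)]
    exact (abs_le_of_sq_le_sq' this (by positivity)).2
  have hr : 2 * r ≤ p + q := by
    have : (2 * r) ^ 2 ≤ (p + q) ^ 2 := by nlinarith
    exact (abs_le_of_sq_le_sq' this (by positivity)).2
  have h1 : (a / p - b / q) ^ 2 ≤ 2 * (p * q - (1 + a * b)) / (p * q) := by
    have : 2 * (p * q - (1 + a * b)) / (p * q) = (a / p - b / q) ^ 2 + (1 / p - 1 / q) ^ 2 := by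
      field_simp
      nlinarith
    rw [this]
    nlinarith [sq_nonneg (1 / p - 1 / q)]
  have h2 : p * q - (1 + a * b) ≤ (p + q) * (p + q - 2 * r) := by
    nlinarith
  have h3 : 2 * (p * q - (1 + a * b)) / (p * q) ≤ 4 * (p + q - 2 * r) := by
    rw [div_le_iff₀ (by positivity)]
    have : p + q ≤ 2 * (p * q) := by nlinarith
    nlinarith
  exact h1.trans h3

theorem exists_tendsto_of_tendsto_div_sqrt {y : ℕ → ℝ} {l R : ℝ}
    (hl : Tendsto (fun n => y n / √(1 + y n ^ 2)) atTop (nhds l))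
    (hR : ∃ᶠ n in atTop, |y n| ≤ R) : ∃ z, Tendsto y atTop (nhds z) := by
  have hsq : ∀ x : ℝ, (x / √(1 + x ^ 2)) ^ 2 = 1 - 1 / (1 + x ^ 2) := by
    intro x
    rw [div_pow, Real.sq_sqrt (by positivity)]
    field_simp
    ring
  have hl1 : l ^ 2 ≤ 1 - 1 / (1 + R ^ 2) := by
    refine le_of_tendsto_of_frequently (hl.pow 2) (hR.mono fun n hn => ?_)
    rw [hsq]
    have h2 : y n ^ 2 ≤ R ^ 2 := sq_le_sq.2 (hn.trans (le_abs_self R))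
    gcongr
  have hpos : 0 < 1 - l ^ 2 := by
    have : 0 < 1 / (1 + R ^ 2) := by positivity
    linarith
  refine ⟨l / √(1 - l ^ 2), ?_⟩
  have := hl.div ((tendsto_const_nhds (x := (1 : ℝ)).sub (hl.pow 2)).sqrt)
    (Real.sqrt_pos.2 hpos).ne'
  refine this.congr fun n => ?_
  have h0 : 0 < √(1 + y n ^ 2) := Real.sqrt_pos.2 (by positivity)
  simp only [hsq, sub_sub_cancel, Pi.div_apply]
  rw [one_div, Real.sqrt_inv]
  field_simp

theorem integrable_sqrt_one_add_sq {μ : Measure Ω} [IsFiniteMeasure μ] {X : Ω → ℝ}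
    (hX : Integrable X μ) : Integrable (fun ω => √(1 + X ω ^ 2)) μ := by
  refine ((integrable_const (1 : ℝ)).add hX.abs).mono' ?_ (ae_of_all _ fun ω => ?_)
  · exact (by fun_prop : Continuous fun x : ℝ => √(1 + x ^ 2)).comp_aestronglyMeasurable hX.1
  · rw [Real.norm_of_nonneg (Real.sqrt_nonneg _)]
    simp only [Pi.add_apply]
    refine Real.sqrt_le_iff.2 ⟨by positivity, ?_⟩
    nlinarith [abs_nonneg (X ω), sq_abs (X ω)]

theorem convex_integrable_bdd (μ : Measure Ω) (C : ℝ) :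
    Convex ℝ {Y : Ω → ℝ | Integrable Y μ ∧ ∫ ω, |Y ω| ∂μ ≤ C} := by
  rintro X ⟨hX, hXC⟩ Y ⟨hY, hYC⟩ a b ha hb hab
  have hi : Integrable (a • X + b • Y) μ := (hX.smul a).add (hY.smul b)
  refine ⟨hi, ?_⟩
  calc ∫ ω, |(a • X + b • Y) ω| ∂μ ≤ ∫ ω, (a * |X ω| + b * |Y ω|) ∂μ := by
        refine integral_mono hi.abs ((hX.abs.const_mul a).add (hY.abs.const_mul b)) fun ω => ?_
        simp only [Pi.add_apply, Pi.smul_apply, smul_eq_mul]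
        refine (abs_add_le _ _).trans ?_
        rw [abs_mul, abs_mul, abs_of_nonneg ha, abs_of_nonneg hb]
    _ = a * ∫ ω, |X ω| ∂μ + b * ∫ ω, |Y ω| ∂μ := by
        rw [integral_add (hX.abs.const_mul a) (hY.abs.const_mul b), integral_const_mul,
          integral_const_mul]
    _ ≤ a * C + b * C := by gcongr
    _ = C := by rw [← add_mul, hab, one_mul]

theorem ae_exists_frequently_abs_le {μ : Measure Ω} {Y : ℕ → Ω → ℝ} {C : ℝ}
    (hY : ∀ n, Integrable (Y n) μ) (hC : ∀ n, ∫ ω, |Y n ω| ∂μ ≤ C) :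
    ∀ᵐ ω ∂μ, ∃ R : ℝ, ∃ᶠ n in atTop, |Y n ω| ≤ R := by
  have h1 : ∫⁻ ω, liminf (fun n => ‖Y n ω‖ₑ) atTop ∂μ ≠ ⊤ := by
    refine ne_top_of_le_ne_top (b := ENNReal.ofReal C) ENNReal.ofReal_ne_top ?_
    refine (lintegral_liminf_le' fun n => (hY n).1.enorm).trans ?_
    refine liminf_le_of_le (by isBoundedDefault) fun b hb => ?_
    obtain ⟨n, hn⟩ := hb.exists
    refine hn.trans ?_
    rw [← ofReal_integral_norm_eq_lintegral_enorm (hY n)]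
    exact ENNReal.ofReal_le_ofReal (hC n)
  have hm : AEMeasurable (fun ω => liminf (fun n => ‖Y n ω‖ₑ) atTop) μ := by
    simp only [liminf_eq_iSup_iInf_of_nat]
    exact AEMeasurable.iSup fun n => AEMeasurable.iInf fun i => AEMeasurable.iInf fun _ =>
      (hY i).1.enorm
  have h2 := ae_lt_top' hm h1
  filter_upwards [h2] with ω hω
  obtain ⟨R, hR, -⟩ := ENNReal.lt_iff_exists_nnreal_btwn.1 hω
  refine ⟨R, ?_⟩
  have := frequently_lt_of_liminf_lt (by isBoundedDefault) hR
  refine this.mono fun n hn => ?_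
  have h3 : ‖Y n ω‖₊ < R := by
    rw [enorm_eq_nnnorm] at hn
    exact_mod_cast hn
  exact_mod_cast h3.le

/-- Every `L¹`-bounded sequence admits forward convex combinations that converge almost surely. -/
theorem exists_isFCC_tendsto_ae {μ : Measure Ω} [IsFiniteMeasure μ] {X : ℕ → Ω → ℝ} {C : ℝ}
    (hX : ∀ n, Integrable (X n) μ) (hC : ∀ n, ∫ ω, |X n ω| ∂μ ≤ C) :
    ∃ Y : ℕ → Ω → ℝ, IsFCC X Y ∧ ∃ Z : Ω → ℝ,
      ∀ᵐ ω ∂μ, Tendsto (fun n => Y n ω) atTop (nhds (Z ω)) := by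
  let Φ : (Ω → ℝ) → ℝ := fun Y => ∫ ω, √(1 + Y ω ^ 2) ∂μ
  let S : ℕ → Set (Ω → ℝ) := fun k => convexHull ℝ (X '' {n | k ≤ n})
  have hSanti : Antitone S := fun k l hkl =>
    convexHull_mono (image_mono fun n (hn : l ≤ n) => hkl.trans hn)
  have hSsub : ∀ k, S k ⊆ {Y : Ω → ℝ | Integrable Y μ ∧ ∫ ω, |Y ω| ∂μ ≤ C} := fun k =>
    convexHull_min (by rintro _ ⟨n, -, rfl⟩; exact ⟨hX n, hC n⟩) (convex_integrable_bdd μ C)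
  have hSne : ∀ k, (Φ '' S k).Nonempty := fun k =>
    ⟨Φ (X k), X k, subset_convexHull _ _ ⟨k, le_refl k, rfl⟩, rfl⟩
  have hSbb : ∀ k, BddBelow (Φ '' S k) := fun k =>
    ⟨0, by rintro _ ⟨Y, -, rfl⟩; exact integral_nonneg fun ω => Real.sqrt_nonneg _⟩
  let α : ℕ → ℝ := fun k => sInf (Φ '' S k)
  have hαmono : Monotone α := fun k l hkl =>
    csInf_le_csInf (hSbb k) (hSne l) (image_mono (hSanti hkl))
  have hαbdd : BddAbove (range α) := by
    refine ⟨∫ ω, (1 : ℝ) ∂μ + C, ?_⟩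
    rintro _ ⟨k, rfl⟩
    refine (csInf_le (hSbb k) ⟨X k, subset_convexHull _ _ ⟨k, le_refl k, rfl⟩, rfl⟩).trans ?_
    calc Φ (X k) ≤ ∫ ω, (1 + |X k ω|) ∂μ := by
          refine integral_mono (integrable_sqrt_one_add_sq (hX k))
            ((integrable_const _).add (hX k).abs) fun ω => ?_
          refine Real.sqrt_le_iff.2 ⟨by positivity, ?_⟩
          nlinarith [abs_nonneg (X k ω), sq_abs (X k ω)]
      _ = ∫ ω, (1 : ℝ) ∂μ + ∫ ω, |X k ω| ∂μ := integral_add (integrable_const _) (hX k).abs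
      _ ≤ _ := by gcongr; exact hC k
  let β : ℝ := ⨆ k, α k
  have hαβ : ∀ k, α k ≤ β := fun k => le_ciSup hαbdd k
  have hαtend : Tendsto α atTop (nhds β) := tendsto_atTop_ciSup hαmono hαbdd
  let η : ℕ → ℝ := fun N => (1 / 4) ^ N / 32
  have hη : ∀ N, 0 < η N := fun N => by positivity
  have hηanti : Antitone η := fun N n h => by
    simp only [η]
    gcongr ?_ / 32
    exact pow_le_pow_of_le_one (by norm_num) (by norm_num) h
  obtain ⟨ψ, hψ, hψη⟩ := extraction_forall_of_eventually
    (P := fun N k => β - η N < α k) fun N => hαtend.eventually_const_lt (by linarith [hη N])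
  have hex : ∀ N, ∃ Y ∈ S (ψ N), Φ Y < β + η N := by
    intro N
    obtain ⟨_, ⟨Y, hY, rfl⟩, hlt⟩ := exists_lt_of_csInf_lt (hSne (ψ N))
      (show α (ψ N) < β + η N by linarith [hαβ (ψ N), hη N])
    exact ⟨Y, hY, hlt⟩
  choose Y hYS hYΦ using hex
  have hYi : ∀ n, Integrable (Y n) μ := fun n => (hSsub _ (hYS n)).1
  refine ⟨Y, fun k => hSanti (hψ.id_le k) (hYS k), ?_⟩
  let T : ℕ → Ω → ℝ := fun n ω => Y n ω / √(1 + Y n ω ^ 2)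
  have hTm : ∀ n, AEStronglyMeasurable (T n) μ := fun n =>
    ((continuous_id.div (by fun_prop : Continuous fun x : ℝ => √(1 + x ^ 2))
      fun x => (Real.sqrt_pos.2 (by positivity)).ne').comp_aestronglyMeasurable (hYi n).1)
  have hgap : ∀ N n m : ℕ, N ≤ n → N ≤ m → Integrable (fun ω => (T n ω - T m ω) ^ 2) μ ∧
      ∫ ω, (T n ω - T m ω) ^ 2 ∂μ ≤ (1 / 4) ^ N / 2 := by
    intro N n m hn hm
    have hmid : (fun ω => (Y n ω + Y m ω) / 2) ∈ S (ψ N) := by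
      have h := (convex_convexHull ℝ (X '' {i | ψ N ≤ i})) (hSanti (hψ.monotone hn) (hYS n))
        (hSanti (hψ.monotone hm) (hYS m)) (by norm_num : (0 : ℝ) ≤ 1 / 2)
        (by norm_num : (0 : ℝ) ≤ 1 / 2) (by norm_num)
      convert h using 1
      ext ω
      simp only [Pi.add_apply, Pi.smul_apply, smul_eq_mul]
      ring
    have hmi := integrable_sqrt_one_add_sq (hSsub _ hmid).1
    have hni := integrable_sqrt_one_add_sq (hYi n)
    have hmi' := integrable_sqrt_one_add_sq (hYi m)
    have hint := ((hni.add hmi').sub (hmi.const_mul 2)).const_mul 4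
    have hle : ∀ ω, (T n ω - T m ω) ^ 2 ≤ 4 * (√(1 + Y n ω ^ 2) + √(1 + Y m ω ^ 2) -
        2 * √(1 + ((Y n ω + Y m ω) / 2) ^ 2)) := fun ω => sq_div_sqrt_sub_le _ _
    have hsqi : Integrable (fun ω => (T n ω - T m ω) ^ 2) μ := by
      refine hint.mono' (((hTm n).sub (hTm m)).pow 2) (ae_of_all _ fun ω => ?_)
      rw [Real.norm_of_nonneg (sq_nonneg _)]
      exact hle ω
    refine ⟨hsqi, (integral_mono hsqi hint hle).trans ?_⟩
    have heq : ∫ ω, 4 * (√(1 + Y n ω ^ 2) + √(1 + Y m ω ^ 2) -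
        2 * √(1 + ((Y n ω + Y m ω) / 2) ^ 2)) ∂μ =
        4 * (Φ (Y n) + Φ (Y m) - 2 * Φ (fun ω => (Y n ω + Y m ω) / 2)) := by
      have h1 := integral_sub (hni.add hmi') (hmi.const_mul 2)
      have h2 := integral_add hni hmi'
      simp only [Pi.add_apply] at h1
      rw [integral_const_mul, h1, h2, integral_const_mul]
    refine heq.le.trans ?_
    have h1 : α (ψ N) ≤ Φ (fun ω => (Y n ω + Y m ω) / 2) := csInf_le (hSbb _) ⟨_, hmid, rfl⟩
    have h2 := hψη N
    have h3 := hYΦ n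
    have h4 := hYΦ m
    have h5 := hηanti hn
    have h6 := hηanti hm
    have h7 : (1 / 4 : ℝ) ^ N = 32 * η N := by simp only [η]; ring
    linarith
  have hcauchy : ∀ᵐ ω ∂μ, ∃ l, Tendsto (fun n => T n ω) atTop (nhds l) := by
    refine Lp.ae_tendsto_of_cauchy_eLpNorm (p := 1)
      (B := fun N => ENNReal.ofReal ((μ.real univ + 1) * (1 / 2) ^ N)) hTm le_rfl ?_ ?_
    · refine (Summable.tsum_ofReal_lt_top ?_).ne
      exact (summable_geometric_of_lt_one (by norm_num) (by norm_num)).mul_left _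
    · intro N n m hn hm
      obtain ⟨hi, hle⟩ := hgap N n m hn hm
      have hpt : ∀ ω, ‖(T n - T m) ω‖ ≤ (1 / 2) ^ N / 2 + 2 ^ N / 2 * (T n ω - T m ω) ^ 2 := by
        intro ω
        have h2 : (1 / 2 : ℝ) ^ N * 2 ^ N = 1 := by rw [← mul_pow]; norm_num
        have hp : (0 : ℝ) < (1 / 2 : ℝ) ^ N := by positivity
        have hp2 : (0 : ℝ) < 2 ^ N := by positivity
        simp only [Pi.sub_apply, Real.norm_eq_abs]
        rw [← sq_abs (T n ω - T m ω)]
        generalize |T n ω - T m ω| = d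
        have : 0 ≤ 2 ^ N / 2 * (d - (1 / 2) ^ N) ^ 2 := by positivity
        nlinarith
      have hri : Integrable (fun ω => (1 / 2 : ℝ) ^ N / 2 + 2 ^ N / 2 * (T n ω - T m ω) ^ 2) μ :=
        (integrable_const _).add (hi.const_mul _)
      have hTi : Integrable (T n - T m) μ :=
        hri.mono' ((hTm n).sub (hTm m)) (ae_of_all _ hpt)
      rw [eLpNorm_one_eq_lintegral_enorm, ← ofReal_integral_norm_eq_lintegral_enorm hTi]
      rw [ENNReal.ofReal_lt_ofReal_iff (by positivity)]
      refine (integral_mono hTi.norm hri hpt).trans_lt ?_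
      rw [integral_add (integrable_const _) (hi.const_mul _), integral_const_mul, integral_const,
        smul_eq_mul]
      have h4 : (2 : ℝ) ^ N * (1 / 4) ^ N = (1 / 2) ^ N := by rw [← mul_pow]; norm_num
      have hp : (0 : ℝ) < (1 / 2 : ℝ) ^ N := by positivity
      have hp2 : (0 : ℝ) < 2 ^ N := by positivity
      have h5 : (0 : ℝ) ≤ μ.real univ := measureReal_nonneg
      nlinarith [mul_le_mul_of_nonneg_left hle hp2.le, mul_nonneg h5 hp.le]
  refine ⟨fun ω => limUnder atTop fun n => Y n ω, ?_⟩
  filter_upwards [hcauchy, ae_exists_frequently_abs_le hYi fun n => (hSsub _ (hYS n)).2]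
    with ω ⟨l, hl⟩ ⟨R, hR⟩
  exact tendsto_nhds_limUnder (exists_tendsto_of_tendsto_div_sqrt hl hR)

theorem exists_measurable_mul_eq_abs {D : ℕ → Set Ω} {f : ℕ → Ω → ℝ}
    (hD : ∀ n, MeasurableSet (D n)) (hdisj : Pairwise fun i j => Disjoint (D i) (D j))
    (hf : ∀ n, Measurable (f n)) :
    ∃ g : Ω → ℝ, Measurable g ∧ (∀ ω, |g ω| ≤ 1) ∧ ∀ n, ∀ ω ∈ D n, g ω * f n ω = |f n ω| := by
  classical
  let P : Set Ω := ⋃ n, D n ∩ {ω | 0 ≤ f n ω}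
  have hP : MeasurableSet P :=
    MeasurableSet.iUnion fun n => (hD n).inter (measurableSet_le measurable_const (hf n))
  refine ⟨fun ω => if ω ∈ P then 1 else -1, Measurable.ite hP measurable_const measurable_const,
    fun ω => ?_, fun n ω hω => ?_⟩
  · dsimp only
    split_ifs <;> simp
  · by_cases h0 : 0 ≤ f n ω
    · have : ω ∈ P := mem_iUnion.2 ⟨n, hω, h0⟩
      simp [this, abs_of_nonneg h0]
    · have : ω ∉ P := by
        intro h
        obtain ⟨m, hm, hm0⟩ := mem_iUnion.1 h
        rcases eq_or_ne m n with rfl | hmn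
        · exact h0 hm0
        · exact disjoint_left.1 (hdisj hmn) hm hω
      simp [this, abs_of_neg (not_le.1 h0)]

/-- If a sequence has concentrated mass at least `a` on sets `B n` shrinking to a null set, and
mass at most `b` on their tail unions, then its forward convex combinations can converge in `L¹`
only if `2 * a ≤ b`. -/
theorem two_mul_le_of_isFCC_tendsto {μ : Measure Ω} {X Y : ℕ → Ω → ℝ} {Z : Ω → ℝ}
    {B : ℕ → Set Ω} {a b : ℝ} (hX : ∀ n, Integrable (X n) μ) (hZ : Integrable Z μ)
    (hY : ∀ n, Integrable (Y n) μ) (hB : ∀ n, MeasurableSet (B n))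
    (hμ : Tendsto (μ ∘ fun m => ⋃ j ≥ m, B j) atTop (nhds 0))
    (ha : ∀ n, a ≤ ∫ ω in B n \ ⋃ j ≥ n + 1, B j, |X n ω| ∂μ)
    (hb : ∀ᶠ m in atTop, ∀ n, ∫ ω in ⋃ j ≥ m, B j, |X n ω| ∂μ ≤ b)
    (hXY : IsFCC X Y) (hYZ : Tendsto (fun n => ∫ ω, |Y n ω - Z ω| ∂μ) atTop (nhds 0)) :
    2 * a ≤ b := by
  let M : ℕ → Set Ω := fun m => ⋃ j ≥ m, B j
  have hM : ∀ m, MeasurableSet (M m) := fun m =>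
    MeasurableSet.iUnion fun j => MeasurableSet.iUnion fun _ => hB j
  let D : ℕ → Set Ω := fun n => B n \ M (n + 1)
  have hD : ∀ n, MeasurableSet (D n) := fun n => (hB n).diff (hM _)
  have hdisj : Pairwise fun i j => Disjoint (D i) (D j) := by
    have key : ∀ i j, i < j → Disjoint (D i) (D j) := fun i j hij =>
      disjoint_left.2 fun ω hi hj => hi.2 (mem_iUnion₂.2 ⟨j, hij, hj.1⟩)
    intro i j hij
    rcases hij.lt_or_gt with h | h
    · exact key i j h
    · exact (key j i h).symm
  have hDM : ∀ m n, m ≤ n → D n ⊆ M m := fun m n hmn ω hω => mem_iUnion₂.2 ⟨n, hmn, hω.1⟩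
  obtain ⟨g, hgm, hg1, hgD⟩ := exists_measurable_mul_eq_abs hD hdisj
    (f := fun n => (hX n).1.mk (X n)) fun n => (hX n).1.stronglyMeasurable_mk.measurable
  have hgi : ∀ {V : Ω → ℝ}, Integrable V μ → Integrable (fun ω => g ω * V ω) μ := fun hV =>
    hV.bdd_mul (c := 1) hgm.aestronglyMeasurable (ae_of_all _ hg1)
  have hgle : ∀ V : Ω → ℝ, ∀ ω, |g ω * V ω| ≤ |V ω| := fun V ω => by
    rw [abs_mul]
    exact mul_le_of_le_one_left (abs_nonneg _) (hg1 ω)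
  have hlow : ∀ m, (∀ n, ∫ ω in M m, |X n ω| ∂μ ≤ b) → ∀ n, m ≤ n →
      2 * a - b ≤ ∫ ω in M m, g ω * X n ω ∂μ := by
    intro m hm n hmn
    have h1 : ∫ ω in M m, ((D n).indicator (fun ω => 2 * |X n ω|) ω - |X n ω|) ∂μ ≤
        ∫ ω in M m, g ω * X n ω ∂μ := by
      refine integral_mono_ae ((((hX n).abs.const_mul 2).indicator (hD n)).sub
        (hX n).abs).integrableOn (hgi (hX n)).integrableOn ?_
      filter_upwards [ae_restrict_of_ae (hX n).1.ae_eq_mk] with ω hω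
      by_cases hωD : ω ∈ D n
      · have := hgD n ω hωD
        rw [← hω] at this
        simp only [indicator_of_mem hωD, this]
        linarith
      · simp only [indicator_of_notMem hωD]
        linarith [(abs_le.1 (hgle (X n) ω)).1]
    rw [integral_sub (((hX n).abs.const_mul 2).indicator (hD n)).integrableOn
      (hX n).abs.integrableOn, setIntegral_indicator (hD n),
      inter_eq_self_of_subset_right (hDM m n hmn), integral_const_mul] at h1
    linarith [ha n, hm n]
  have hlowY : ∀ᶠ m in atTop, 2 * a - b ≤ ∫ ω in M m, g ω * Y m ω ∂μ := by
    filter_upwards [hb] with m hm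
    have hconv : Convex ℝ {V : Ω → ℝ | Integrable V μ ∧ 2 * a - b ≤ ∫ ω in M m, g ω * V ω ∂μ} := by
      rintro V ⟨hV, hVl⟩ W ⟨hW, hWl⟩ s t hs ht hst
      refine ⟨(hV.smul s).add (hW.smul t), ?_⟩
      have : ∫ ω in M m, g ω * (s • V + t • W) ω ∂μ =
          s * ∫ ω in M m, g ω * V ω ∂μ + t * ∫ ω in M m, g ω * W ω ∂μ := by
        rw [← integral_const_mul, ← integral_const_mul, ← integral_add
          ((hgi hV).integrableOn.const_mul s) ((hgi hW).integrableOn.const_mul t)]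
        congr 1
        ext ω
        simp only [Pi.add_apply, Pi.smul_apply, smul_eq_mul]
        ring
      rw [this]
      calc 2 * a - b = s * (2 * a - b) + t * (2 * a - b) := by rw [← add_mul, hst, one_mul]
        _ ≤ _ := by gcongr
    refine (convexHull_min ?_ hconv (hXY m)).2
    rintro _ ⟨n, hn, rfl⟩
    exact ⟨hX n, hlow m hm n hn⟩
  have hup : ∀ m, ∫ ω in M m, g ω * Y m ω ∂μ ≤
      ∫ ω, |Y m ω - Z ω| ∂μ + ∫ ω in M m, |Z ω| ∂μ := by
    intro m
    have hd := ((hY m).sub hZ).abs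
    calc ∫ ω in M m, g ω * Y m ω ∂μ ≤ ∫ ω in M m, (|Y m ω - Z ω| + |Z ω|) ∂μ := by
          refine integral_mono (hgi (hY m)).integrableOn (hd.add hZ.abs).integrableOn fun ω => ?_
          refine (le_abs_self _).trans ((hgle (Y m) ω).trans ?_)
          simpa using abs_add_le (Y m ω - Z ω) (Z ω)
      _ = ∫ ω in M m, |Y m ω - Z ω| ∂μ + ∫ ω in M m, |Z ω| ∂μ :=
          integral_add hd.integrableOn hZ.abs.integrableOn
      _ ≤ _ := by
          gcongr ?_ + _
          exact setIntegral_le_integral hd (ae_of_all _ fun ω => abs_nonneg _)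
  have hlim := hYZ.add (hZ.abs.tendsto_setIntegral_nhds_zero hμ)
  rw [add_zero] at hlim
  have := ge_of_tendsto hlim (hlowY.mono fun m hm => hm.trans (hup m))
  linarith

theorem tendsto_measure_biUnion_ge {μ : Measure Ω} {B : ℕ → Set Ω}
    (h : ∑' n, μ (B n) ≠ ⊤) : Tendsto (μ ∘ fun m => ⋃ j ≥ m, B j) atTop (nhds 0) := by
  refine tendsto_of_tendsto_of_tendsto_of_le_of_le tendsto_const_nhds
    (ENNReal.tendsto_sum_nat_add _ h) (fun _ => zero_le) fun m => ?_
  refine (measure_mono ?_).trans (measure_iUnion_le _)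
  refine iUnion₂_subset fun j hj => ?_
  obtain ⟨k, rfl⟩ := Nat.exists_eq_add_of_le' hj
  exact subset_iUnion (fun k => B (k + m)) k

/-- If convergence in measure to points of a closed convex `L¹`-bounded set `K` implies
convergence in `L¹`, then `K` is uniformly integrable. -/
theorem uiset_of_tendsto {μ : Measure Ω} [IsFiniteMeasure μ] {K : Set (Ω → ℝ)}
    (hKconv : Convex ℝ K) (hKbdd : BddL1 μ K)
    (hKclosed : ∀ X ∈ probClosure μ K, ∃ X' ∈ K, X =ᵐ[μ] X')
    (hK : ∀ (Xs : ℕ → Ω → ℝ) (X : Ω → ℝ), (∀ n, Xs n ∈ K) → X ∈ K →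
      TendstoInMeasure μ Xs atTop X →
        Tendsto (fun n => ∫ ω, |Xs n ω - X ω| ∂μ) atTop (nhds 0)) :
    UIset μ K := by
  obtain ⟨hKi, C, hC⟩ := hKbdd
  refine ⟨hKi, ?_⟩
  by_contra! hcon
  obtain ⟨ε₀, hε₀, hbig⟩ := hcon
  let A : Set ℝ := {t | ∃ c : ℝ, ∀ X ∈ K, ∫ ω in {ω | c < |X ω|}, |X ω| ∂μ ≤ t}
  have hAlb : ∀ t ∈ A, ε₀ ≤ t := by
    rintro t ⟨c, hc⟩
    obtain ⟨X, hXK, hX⟩ := hbig c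
    exact hX.trans (hc X hXK)
  have hAne : A.Nonempty := ⟨C, 0, fun X hX =>
    (setIntegral_le_integral (hKi X hX).abs (ae_of_all _ fun ω => abs_nonneg _)).trans (hC X hX)⟩
  set δ := sInf A
  have hδ : 0 < δ := hε₀.trans_le (le_csInf hAne hAlb)
  set ε := δ / 16 with hε
  obtain ⟨t, ⟨c₀, hc₀⟩, ht⟩ := exists_lt_of_csInf_lt hAne (show δ < δ + ε by linarith)
  have hex : ∀ n : ℕ, ∃ X ∈ K, δ - ε < ∫ ω in {ω | (2 : ℝ) ^ n < |X ω|}, |X ω| ∂μ := by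
    intro n
    by_contra! hn
    have : δ ≤ δ - ε := csInf_le ⟨ε₀, hAlb⟩ ⟨2 ^ n, hn⟩
    linarith
  choose X hXK hXbig using hex
  have hXi : ∀ n, Integrable (X n) μ := fun n => hKi _ (hXK n)
  let B : ℕ → Set Ω := fun n => {ω | (2 : ℝ) ^ n < |(hXi n).1.mk (X n) ω|}
  have hB : ∀ n, MeasurableSet (B n) := fun n =>
    measurableSet_lt measurable_const (hXi n).1.stronglyMeasurable_mk.measurable.norm
  have hBX : ∀ n, {ω | (2 : ℝ) ^ n < |X n ω|} =ᵐ[μ] B n := fun n => by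
    filter_upwards [(hXi n).1.ae_eq_mk] with ω hω
    exact propext (by
      change (2 : ℝ) ^ n < |X n ω| ↔ (2 : ℝ) ^ n < |(hXi n).1.mk (X n) ω|
      rw [hω])
  have hBbig : ∀ n, δ - ε < ∫ ω in B n, |X n ω| ∂μ := fun n => by
    rw [← setIntegral_congr_set (hBX n)]
    exact hXbig n
  have hBμ : ∑' n, μ (B n) ≠ ⊤ := by
    have hle : ∀ n, μ (B n) ≤ ENNReal.ofReal (C * (1 / 2) ^ n) := by
      intro n
      rw [← measure_congr (hBX n), ← ofReal_measureReal]
      refine ENNReal.ofReal_le_ofReal ?_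
      have h1 := mul_meas_ge_le_integral_of_nonneg (μ := μ) (f := fun ω => |X n ω|)
        (ae_of_all _ fun ω => abs_nonneg _) (hXi n).abs (2 ^ n)
      have h2 : μ.real {ω | (2 : ℝ) ^ n < |X n ω|} ≤ μ.real {ω | (2 : ℝ) ^ n ≤ |X n ω|} :=
        measureReal_mono fun ω (hω : (2 : ℝ) ^ n < |X n ω|) => hω.le
      have h3 := hC _ (hXK n)
      have h4 : (2 : ℝ) ^ n * (1 / 2) ^ n = 1 := by rw [← mul_pow]; norm_num
      have hp : (0 : ℝ) < 2 ^ n := by positivity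
      have h5 : (2 : ℝ) ^ n * μ.real {ω | (2 : ℝ) ^ n < |X n ω|} ≤
          2 ^ n * (C * (1 / 2) ^ n) := by
        calc _ ≤ (2 : ℝ) ^ n * μ.real {ω | (2 : ℝ) ^ n ≤ |X n ω|} := by gcongr
          _ ≤ C := h1.trans h3
          _ = C * (2 ^ n * (1 / 2) ^ n) := by rw [h4, mul_one]
          _ = _ := by ring
      exact le_of_mul_le_mul_left h5 hp
    refine ((ENNReal.tsum_le_tsum hle).trans_lt (Summable.tsum_ofReal_lt_top ?_)).ne
    exact (summable_geometric_of_lt_one (by norm_num) (by norm_num)).mul_left _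
  have hBtail := tendsto_measure_biUnion_ge hBμ
  obtain ⟨f, -, hf⟩ := exists_seq_of_forall_finset_exists (fun _ : ℕ => True)
    (fun x y => x < y ∧ ∫ ω in ⋃ j ≥ y, B j, |X x ω| ∂μ < ε) fun s _ => by
      have : ∀ᶠ y in atTop, ∀ x ∈ s, x < y ∧ ∫ ω in ⋃ j ≥ y, B j, |X x ω| ∂μ < ε := by
        rw [Filter.eventually_all_finset]
        intro x _
        exact (eventually_gt_atTop x).and
          (((hXi x).abs.tendsto_setIntegral_nhds_zero hBtail).eventually_lt_const
            (show 0 < ε by positivity))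
      obtain ⟨y, hy⟩ := this.exists
      exact ⟨y, trivial, hy⟩
  have hfmono : StrictMono f := fun m n hmn => (hf m n hmn).1
  have hsub : ∀ m, (⋃ j ≥ m, B (f j)) ⊆ ⋃ j ≥ f m, B j := fun m =>
    iUnion₂_subset fun j hj => subset_iUnion₂_of_subset (f j) (hfmono.monotone hj) subset_rfl
  have hBf : Tendsto (μ ∘ fun m => ⋃ j ≥ m, B (f j)) atTop (nhds 0) :=
    tendsto_of_tendsto_of_tendsto_of_le_of_le tendsto_const_nhds
      (hBtail.comp hfmono.tendsto_atTop) (fun _ => zero_le) fun m => measure_mono (hsub m)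
  have hmeas : ∀ m, MeasurableSet (⋃ j ≥ m, B (f j)) := fun m =>
    MeasurableSet.iUnion fun j => MeasurableSet.iUnion fun _ => hB (f j)
  obtain ⟨Y, hXY, Z, hYZ⟩ := exists_isFCC_tendsto_ae (X := fun n => X (f n))
    (fun n => hXi (f n)) fun n => hC _ (hXK (f n))
  have hYK : ∀ n, Y n ∈ K := fun n =>
    convexHull_min (by rintro _ ⟨i, -, rfl⟩; exact hXK (f i)) hKconv (hXY n)
  have hYmeas := tendstoInMeasure_of_tendsto_ae (fun n => (hKi _ (hYK n)).1) hYZ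
  obtain ⟨W, hWK, hZW⟩ := hKclosed Z ⟨Y, hYK, hYmeas⟩
  have hYW := hK Y W hYK hWK (hYmeas.congr_right hZW)
  have hfinal := two_mul_le_of_isFCC_tendsto (a := δ - 2 * ε) (b := δ + 2 * ε)
    (fun n => hXi (f n)) (hKi W hWK) (fun n => hKi _ (hYK n)) (fun n => hB (f n)) hBf ?_ ?_ hXY hYW
  · linarith
  · intro n
    have h1 := integral_inter_add_sdiff (μ := μ) (s := B (f n)) (hmeas (n + 1))
      (hXi (f n)).abs.integrableOn
    have h2 : ∫ ω in B (f n) ∩ ⋃ j ≥ n + 1, B (f j), |X (f n) ω| ∂μ < ε := by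
      refine (setIntegral_mono_set (hXi (f n)).abs.integrableOn
        (ae_of_all _ fun ω => abs_nonneg _) ?_).trans_lt (hf n (n + 1) n.lt_succ_self).2
      exact LE.le.eventuallyLE (inter_subset_right.trans (hsub (n + 1)))
    have h3 := hBbig (f n)
    linarith
  · have hreal : Tendsto (fun m => |c₀| * μ.real (⋃ j ≥ m, B (f j))) atTop (nhds 0) := by
      have := ((ENNReal.tendsto_toReal ENNReal.zero_ne_top).comp hBf).const_mul |c₀|
      simpa [Measure.real] using this
    filter_upwards [hreal.eventually_lt_const (show 0 < ε by positivity)] with m hm n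
    have hnull : NullMeasurableSet {ω | c₀ < |X (f n) ω|} μ :=
      nullMeasurableSet_lt aemeasurable_const (hXi (f n)).abs.aemeasurable
    have h1 : ∫ ω in ⋃ j ≥ m, B (f j), |X (f n) ω| ∂μ ≤
        ∫ ω in ⋃ j ≥ m, B (f j), ({ω | c₀ < |X (f n) ω|}.indicator (fun ω => |X (f n) ω|) ω +
          |c₀|) ∂μ := by
      refine integral_mono (hXi (f n)).abs.integrableOn
        (((hXi (f n)).abs.indicator₀ hnull).add (integrable_const _)).integrableOn fun ω => ?_
      by_cases h : c₀ < |X (f n) ω|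
      · simp only [indicator_of_mem (show ω ∈ {ω | c₀ < |X (f n) ω|} from h)]
        linarith [abs_nonneg c₀]
      · simp only [indicator_of_notMem (show ω ∉ {ω | c₀ < |X (f n) ω|} from h)]
        linarith [le_abs_self c₀]
    rw [integral_add ((hXi (f n)).abs.indicator₀ hnull).integrableOn
      (integrable_const _).integrableOn, setIntegral_const, smul_eq_mul] at h1
    have h2 : ∫ ω in ⋃ j ≥ m, B (f j),
        {ω | c₀ < |X (f n) ω|}.indicator (fun ω => |X (f n) ω|) ω ∂μ ≤
          ∫ ω in {ω | c₀ < |X (f n) ω|}, |X (f n) ω| ∂μ := by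
      rw [← integral_indicator₀ hnull]
      exact setIntegral_le_integral ((hXi (f n)).abs.indicator₀ hnull)
        (ae_of_all _ fun ω => indicator_nonneg (fun _ _ => abs_nonneg _) ω)
    have h3 := hc₀ _ (hXK (f n))
    linarith

theorem tendstoInMeasure_of_absolutelyContinuous {μ ν : Measure Ω} [IsFiniteMeasure μ]
    [IsFiniteMeasure ν] (hνμ : ν ≪ μ) {Xs : ℕ → Ω → ℝ} {X : Ω → ℝ}
    (h : TendstoInMeasure μ Xs atTop X) : TendstoInMeasure ν Xs atTop X := by
  intro ε hε
  have := tendsto_setLIntegral_zero (Measure.lintegral_rnDeriv_lt_top ν μ).ne (h ε hε)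
  simpa only [Measure.setLIntegral_rnDeriv hνμ] using this

/-- Two equivalent probability measures dominate, up to a constant, a third equivalent one. -/
theorem exists_equivProb_le_smul {P Q : Measure Ω} [IsProbabilityMeasure P] (hQ : EquivProb P Q) :
    ∃ R : Measure Ω, EquivProb P R ∧ ∃ r : ENNReal, r ≠ ⊤ ∧ R ≤ r • P ∧ R ≤ r • Q := by
  obtain ⟨_, hQP, hPQ⟩ := hQ
  let f : Ω → ENNReal := fun ω => min 1 (Q.rnDeriv P ω)
  let R₀ : Measure Ω := P.withDensity f
  have hfm : Measurable f := measurable_const.min (Measure.measurable_rnDeriv Q P)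
  have hR₀P : R₀ ≤ P := by
    conv_rhs => rw [← withDensity_one (μ := P)]
    exact withDensity_mono (ae_of_all _ fun ω => min_le_left _ _)
  have hR₀Q : R₀ ≤ Q := by
    conv_rhs => rw [← Measure.withDensity_rnDeriv_eq Q P hQP]
    exact withDensity_mono (ae_of_all _ fun ω => min_le_right _ _)
  have hPR₀ : P ≪ R₀ := by
    refine withDensity_absolutelyContinuous' hfm.aemeasurable ?_
    filter_upwards [hPQ.ae_le (Measure.rnDeriv_pos hQP)] with ω hω
    exact (lt_min one_pos hω).ne'
  have : IsFiniteMeasure R₀ := isFiniteMeasure_of_le P hR₀P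
  have : NeZero R₀ := ⟨fun h0 => IsProbabilityMeasure.ne_zero P
    (Measure.absolutelyContinuous_zero_iff.1 (h0 ▸ hPR₀))⟩
  have hne : (R₀ univ)⁻¹ ≠ 0 := ENNReal.inv_ne_zero.2 (measure_ne_top _ _)
  have hnt : (R₀ univ)⁻¹ ≠ ⊤ := ENNReal.inv_ne_top.2 (NeZero.ne _)
  refine ⟨(R₀ univ)⁻¹ • R₀, ⟨inferInstance, ?_, ?_⟩, (R₀ univ)⁻¹, hnt, ?_, ?_⟩
  · exact (Measure.absolutelyContinuous_of_le hR₀P).smul_left _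
  · exact hPR₀.trans (Measure.absolutelyContinuous_smul hne)
  · gcongr
  · gcongr

theorem exists_uiset_of_topAgree {P Q : Measure Ω} [IsProbabilityMeasure P] {K : Set (Ω → ℝ)}
    (hKconv : Convex ℝ K) (hKbdd : BddL1 P K)
    (hKclosed : ∀ X ∈ probClosure P K, ∃ X' ∈ K, X =ᵐ[P] X')
    (hQ : EquivProb P Q) (hPQ : TopAgree P Q K) : ∃ ν, EquivProb P ν ∧ UIset ν K := by
  obtain ⟨ν, hν, r, hr, hνP, hνQ⟩ := exists_equivProb_le_smul hQ
  have := hν.1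
  have hKi : ∀ X ∈ K, Integrable X ν := fun X hX =>
    ((hKbdd.1 X hX).smul_measure hr).mono_measure hνP
  refine ⟨ν, hν, uiset_of_tendsto hKconv ⟨hKi, ?_⟩ ?_ ?_⟩
  · obtain ⟨C, hC⟩ := hKbdd.2
    refine ⟨r.toReal * C, fun X hX => ?_⟩
    calc ∫ ω, |X ω| ∂ν ≤ ∫ ω, |X ω| ∂(r • P) :=
          integral_mono_measure hνP (ae_of_all _ fun ω => abs_nonneg _)
            ((hKbdd.1 X hX).smul_measure hr).abs
      _ = r.toReal * ∫ ω, |X ω| ∂P := by rw [integral_smul_measure, smul_eq_mul]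
      _ ≤ _ := by gcongr; exact hC X hX
  · rintro X ⟨Xs, hXs, hX⟩
    obtain ⟨X', hX', hXX'⟩ :=
      hKclosed X ⟨Xs, hXs, tendstoInMeasure_of_absolutelyContinuous hν.2.2 hX⟩
    exact ⟨X', hX', hν.2.1.ae_le hXX'⟩
  · intro Xs X hXs hX hlim
    have h1 := (hPQ Xs X hXs hX).1 (tendstoInMeasure_of_absolutelyContinuous hν.2.2 hlim)
    have h2 : Tendsto (fun n => ∫⁻ ω, ENNReal.ofReal |Xs n ω - X ω| ∂ν) atTop (nhds 0) := by
      have h3 := ENNReal.Tendsto.const_mul (a := r) h1 (Or.inr hr)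
      rw [mul_zero] at h3
      refine tendsto_of_tendsto_of_tendsto_of_le_of_le tendsto_const_nhds h3
        (fun _ => zero_le) fun n => ?_
      refine (lintegral_mono' hνQ le_rfl).trans ?_
      rw [lintegral_smul_measure, smul_eq_mul]
    have h4 := (ENNReal.tendsto_toReal ENNReal.zero_ne_top).comp h2
    refine h4.congr fun n => ?_
    exact (integral_eq_lintegral_of_nonneg_ae (ae_of_all _ fun ω => abs_nonneg _)
      ((hKi _ (hXs n)).sub (hKi X hX)).abs.1).symm

theorem UIset.unifIntegrable {Q : Measure Ω} {K : Set (Ω → ℝ)} (hK : UIset Q K)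
    {Xs : ℕ → Ω → ℝ} (hXs : ∀ n, Xs n ∈ K) : UnifIntegrable Xs 1 Q := by
  refine unifIntegrable_of le_rfl ENNReal.one_ne_top (fun n => (hK.1 _ (hXs n)).1) fun ε hε => ?_
  obtain ⟨c, hc⟩ := hK.2 ε hε
  refine ⟨c.toNNReal + 1, fun n => ?_⟩
  have hi := hK.1 _ (hXs n)
  have hnull : NullMeasurableSet {ω | c < |Xs n ω|} Q :=
    nullMeasurableSet_lt aemeasurable_const hi.abs.aemeasurable
  calc eLpNorm ({ω | c.toNNReal + 1 ≤ ‖Xs n ω‖₊}.indicator (Xs n)) 1 Q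
      ≤ eLpNorm ({ω | c < |Xs n ω|}.indicator (Xs n)) 1 Q := by
        refine eLpNorm_mono fun ω => ?_
        refine norm_indicator_le_of_subset (fun ω' hω' => ?_) _ _
        have h1 : ((c.toNNReal + 1 : NNReal) : ℝ) ≤ ‖Xs n ω'‖ := NNReal.coe_le_coe.2 hω'
        rw [NNReal.coe_add, NNReal.coe_one, Real.norm_eq_abs] at h1
        change c < |Xs n ω'|
        linarith [Real.le_coe_toNNReal c]
    _ = ENNReal.ofReal (∫ ω in {ω | c < |Xs n ω|}, |Xs n ω| ∂Q) := by
        rw [eLpNorm_one_eq_lintegral_enorm,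
          ← ofReal_integral_norm_eq_lintegral_enorm (hi.indicator₀ hnull),
          ← integral_indicator₀ hnull]
        simp only [norm_indicator_eq_indicator_norm, Real.norm_eq_abs]
    _ ≤ ENNReal.ofReal ε := ENNReal.ofReal_le_ofReal (hc _ (hXs n)).le

theorem UIset.topAgree {P Q : Measure Ω} [IsProbabilityMeasure P] {K : Set (Ω → ℝ)}
    (hQ : EquivProb P Q) (hK : UIset Q K) : TopAgree P Q K := by
  obtain ⟨_, hQP, hPQ⟩ := hQ
  intro Xs X hXs hX
  have hm : ∀ n, AEStronglyMeasurable (Xs n) Q := fun n => (hK.1 _ (hXs n)).1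
  have heq : (fun n => ∫⁻ ω, ENNReal.ofReal |Xs n ω - X ω| ∂Q) =
      fun n => eLpNorm (Xs n - X) 1 Q := by
    ext n
    rw [eLpNorm_one_eq_lintegral_enorm]
    refine lintegral_congr fun ω => ?_
    rw [Pi.sub_apply, ← Real.norm_eq_abs, ofReal_norm]
  rw [heq]
  constructor
  · intro h
    exact tendsto_Lp_finite_of_tendstoInMeasure le_rfl ENNReal.one_ne_top hm
      (memLp_one_iff_integrable.2 (hK.1 X hX)) (hK.unifIntegrable hXs)
      (tendstoInMeasure_of_absolutelyContinuous hQP h)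
  · intro h
    exact tendstoInMeasure_of_absolutelyContinuous hPQ
      (tendstoInMeasure_of_tendsto_eLpNorm one_ne_zero hm (hK.1 X hX).1 h)

/-- Theorem 1.3: for a convex `L¹(P)`-bounded set `K` closed in probability, agreement of the
`L⁰(Q)`- and `L¹(Q)`-topologies on `K` for some equivalent `Q` is equivalent to
`Q'`-uniform integrability of `K` for some equivalent `Q'`. -/
theorem statement3 (P : Measure Ω) [IsProbabilityMeasure P]
    (K : Set (Ω → ℝ)) (hKconv : Convex ℝ K) (hKbdd : BddL1 P K)
    (hKclosed : ∀ X ∈ probClosure P K, ∃ X' ∈ K, X =ᵐ[P] X') :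
    (∃ Q : Measure Ω, EquivProb P Q ∧ TopAgree P Q K) ↔
      (∃ Q : Measure Ω, EquivProb P Q ∧ UIset Q K) := by
  constructor
  · rintro ⟨Q, hQ, hPQ⟩
    exact exists_uiset_of_topAgree hKconv hKbdd hKclosed hQ hPQ
  · rintro ⟨Q, hQ, hK⟩
    exact ⟨Q, hQ, hK.topAgree hQ⟩

end Paper
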